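/- Let p be a prime number, let n ∈ ℕ, and let F be an ultrafilter on ℕ⁺ such that the set {m ∈ ℕ⁺ : pⁿ ∣ m and pⁿ⁺¹ ∤ m} belongs to F (i.e., pⁿ exactly divides F). Let G = Ultrafilter.map (fun m => p·m) F be the pushforward of F under multiplication by p. Then G is an immediate ˜∣-successor of F: F ˜∣ G, not G ˜∣ F, and for every ultrafilter H on ℕ⁺ with F ˜∣ H and H ˜∣ G, either H =∼ F or H =∼ G. -/

import Mathlib

/-- A set of positive integers is upward closed under divisibility. -/
def UpClosed (A : Set ℕ+) : Prop := ∀ a ∈ A, ∀ b : ℕ+, a ∣ b → b ∈ A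

/-- The divisibility relation `F ˜∣ G` on ultrafilters on `ℕ⁺`: every upward
closed set belonging to `F` also belongs to `G`. -/
def UDvd (F G : Ultrafilter ℕ+) : Prop :=
  ∀ A : Set ℕ+, UpClosed A → A ∈ F → A ∈ G

/-- If `m ∣ k` and the prime power `p ^ n` divides `k` but not `m`, then `p * m ∣ k`. -/
theorem PNat.mul_dvd_of_prime_pow_dvd {p m k : ℕ+} (hp : Nat.Prime (p : ℕ)) {n : ℕ}
    (hmk : m ∣ k) (hk : p ^ n ∣ k) (hm : ¬ p ^ n ∣ m) : p * m ∣ k := by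
  obtain ⟨c, rfl⟩ := hmk
  by_cases hc : p ∣ c
  · rw [mul_comm p m]
    exact mul_dvd_mul_left m hc
  · refine absurd ?_ hm
    rw [PNat.dvd_iff] at hk hc ⊢
    rw [PNat.mul_coe, PNat.pow_coe] at hk
    rw [PNat.pow_coe]
    exact (((Nat.Prime.coprime_iff_not_dvd hp).2 hc).pow_left n).dvd_of_dvd_mul_right hk

theorem upClosed_setOf_dvd (a : ℕ+) : UpClosed {m | a ∣ m} :=
  fun _ hb _ hbc => dvd_trans hb hbc

/-- The upward closure of a set of positive integers under divisibility is upward closed. -/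
theorem upClosed_upwardClosure (A : Set ℕ+) : UpClosed {m | ∃ a ∈ A, a ∣ m} :=
  fun _ ⟨a, ha, hab⟩ _ hbc => ⟨a, ha, dvd_trans hab hbc⟩

theorem mul_left_pnat_dvd_mul_left_iff {p a b : ℕ+} : p * a ∣ p * b ↔ a ∣ b := by
  simp only [PNat.dvd_iff, PNat.mul_coe]
  exact Nat.mul_dvd_mul_iff_left p.pos

/-- If `pⁿ` exactly divides `F` (`p` prime), then the pushforward of `F` under
multiplication by `p` is an immediate `˜∣`-successor of `F`. -/
theorem stmt16 (p : ℕ+) (hp : Nat.Prime (p : ℕ)) (n : ℕ) (F : Ultrafilter ℕ+)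
    (hF : {m : ℕ+ | p ^ n ∣ m ∧ ¬ p ^ (n + 1) ∣ m} ∈ F) :
    UDvd F (Ultrafilter.map (fun m => p * m) F) ∧
    ¬ UDvd (Ultrafilter.map (fun m => p * m) F) F ∧
    ∀ H : Ultrafilter ℕ+, UDvd F H → UDvd H (Ultrafilter.map (fun m => p * m) F) →
      (UDvd H F ∧ UDvd F H) ∨
      (UDvd H (Ultrafilter.map (fun m => p * m) F) ∧
       UDvd (Ultrafilter.map (fun m => p * m) F) H) := by
  refine ⟨?_, ?_, ?_⟩
  · intro A hA hAF
    rw [Ultrafilter.mem_map]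
    filter_upwards [hAF] with m hm
    exact hA m hm _ (dvd_mul_left m p)
  · intro h
    have h₁ := h _ (upClosed_setOf_dvd (p ^ (n + 1))) (by
      rw [Ultrafilter.mem_map]
      filter_upwards [hF] with m hm
      change p ^ (n + 1) ∣ p * m
      rw [pow_succ']
      exact mul_left_pnat_dvd_mul_left_iff.2 hm.1)
    obtain ⟨m, hm, hm'⟩ := F.nonempty_of_mem (Filter.inter_mem hF h₁)
    exact hm.2 hm'
  · intro H hFH hHG
    by_cases hH : {m : ℕ+ | p ^ (n + 1) ∣ m} ∈ H
    · refine Or.inr ⟨hHG, fun A hA hAG => ?_⟩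
      rw [Ultrafilter.mem_map] at hAG
      have h₁ := hFH _ (upClosed_upwardClosure _) (by
        filter_upwards [Filter.inter_mem hF hAG] with m hm
        exact ⟨m, hm, dvd_rfl⟩)
      filter_upwards [hH, h₁] with k hk hmk
      obtain ⟨m, hm, hmk⟩ := hmk
      exact hA _ hm.2 _ (PNat.mul_dvd_of_prime_pow_dvd hp hmk hk hm.1.2)
    · refine Or.inl ⟨fun A hA hAH => ?_, hFH⟩
      have h₁ := hHG _ (upClosed_upwardClosure _) (by
        filter_upwards [Ultrafilter.compl_mem_iff_notMem.2 hH, hAH] with a ha haA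
        exact (⟨a, ⟨haA, ha⟩, dvd_rfl⟩ :
          ∃ b ∈ A ∩ {m : ℕ+ | p ^ (n + 1) ∣ m}ᶜ, b ∣ a))
      rw [Ultrafilter.mem_map] at h₁
      filter_upwards [hF, h₁] with m hm ham
      obtain ⟨a, ha, ham⟩ := ham
      have hpm : p ^ (n + 1) ∣ p * m := by
        rw [pow_succ']
        exact mul_left_pnat_dvd_mul_left_iff.2 hm.1
      exact hA a ha.1 m (mul_left_pnat_dvd_mul_left_iff.1
        (PNat.mul_dvd_of_prime_pow_dvd hp ham hpm ha.2))
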